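/- Let SU(2) act on V = sl₂(ℂ) ⊕ ℂ² by g·(A, v) = (gAg⁻¹, gv), with moment map J : V → su(2)*, J(A,v)(ξ) = Im( tr((ξA − Aξ)A*) + ⟨ξv, v⟩ ) for ξ ∈ su(2), and set M = J⁻¹(0) and M₀ = M/SU(2) with the quotient topology. Then for every m ≥ 1 and every finite subgroup H of U(m), there is no orbit-type-stratum-preserving ℤ-graded regular diffeomorphism from M₀ to the linear symplectic orbifold ℂᵐ/H. -/

import Mathlib

/-!
Statement 10: For the SU(2)-module `V = sl₂(ℂ) ⊕ ℂ²` (≅ R₂ ⊕ R₁), with moment map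
`J(A,v)(ξ) = Im(tr((ξA − Aξ)A*) + ⟨ξv,v⟩)` and symplectic quotient `M₀ = J⁻¹(0)/SU(2)`,
there is no orbit-type-stratum-preserving ℤ-graded regular diffeomorphism from `M₀` to any
linear symplectic orbifold `ℂᵐ/H`.
-/

namespace Stmt10

noncomputable section

open MvPolynomial Complex

/-- Evaluation of a real polynomial in the real coordinates (indexed by `ι × Bool`) at a
point of `ι → ℂ`. -/
def evalR {ι : Type} (p : MvPolynomial (ι × Bool) ℝ) (z : ι → ℂ) : ℝ :=
  MvPolynomial.eval (fun q => if q.2 then (z q.1).im else (z q.1).re) p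

/-- SU(2), the subgroup of the unitary group `U(2)` of matrices of determinant 1. -/
def SU2 : Subgroup (Matrix.unitaryGroup (Fin 2) ℂ) where
  carrier := {g | (g : Matrix (Fin 2) (Fin 2) ℂ).det = 1}
  mul_mem' := by
    intro a b ha hb
    simp only [Set.mem_setOf_eq, Matrix.UnitaryGroup.mul_val] at *
    rw [Matrix.det_mul, ha, hb, mul_one]
  one_mem' := by
    simp only [Set.mem_setOf_eq, Matrix.UnitaryGroup.one_val, Matrix.det_one]
  inv_mem' := by
    intro a ha
    simp only [Set.mem_setOf_eq, Matrix.UnitaryGroup.inv_val] at *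
    rw [Matrix.star_eq_conjTranspose, Matrix.det_conjTranspose, ha, star_one]

/-- The ambient space `M₂(ℂ) ⊕ ℂ²`; the module `V = sl₂(ℂ) ⊕ ℂ²` is the subspace of pairs
whose matrix part is traceless. -/
abbrev W : Type := Matrix (Fin 2) (Fin 2) ℂ × (Fin 2 → ℂ)

/-- The subspace `V = sl₂(ℂ) ⊕ ℂ²` of `W`. -/
def Vsub : Set W := {x | x.1.trace = 0}

/-- The matrix of an element of SU(2). -/
def mg (g : ↥SU2) : Matrix (Fin 2) (Fin 2) ℂ :=
  ((g : Matrix.unitaryGroup (Fin 2) ℂ) : Matrix (Fin 2) (Fin 2) ℂ)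

/-- The action `g·(A,v) = (gAg⁻¹, gv)`. -/
def act (g : ↥SU2) (x : W) : W :=
  (mg g * x.1 * mg g⁻¹, (mg g).mulVec x.2)

/-- The zero set `M = J⁻¹(0) ⊆ V` of the moment map
`J(A,v)(ξ) = Im(tr((ξA − Aξ)A*) + ⟨ξv,v⟩)`, `ξ` ranging over `su(2)` (traceless
skew-hermitian matrices). -/
def Mset : Set W :=
  {x | x.1.trace = 0 ∧
    ∀ ξ : Matrix (Fin 2) (Fin 2) ℂ, ξ.trace = 0 → star ξ = -ξ →
      (((ξ * x.1 - x.1 * ξ) * star x.1).trace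
        + ∑ i, ξ.mulVec x.2 i * (starRingEnd ℂ) (x.2 i)).im = 0}

/-- Orbit equivalence on `M` for the SU(2)-action. -/
def relM (x y : Mset) : Prop := ∃ g : ↥SU2, (y : W) = act g (x : W)

/-- The symplectic quotient `M₀ = M/SU(2)` with the quotient topology. -/
def M₀ : Type := Quot relM

instance : TopologicalSpace M₀ := instTopologicalSpaceQuot

/-- The complex coordinates of a point of `W`. -/
def cc (x : W) : (Fin 2 × Fin 2) ⊕ Fin 2 → ℂ :=
  Sum.elim (fun p => x.1 p.1 p.2) x.2

/-- The degree-`d` regular functions on `M₀`: functions induced by restriction to `M` of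
SU(2)-invariant real polynomial functions on `V` homogeneous of degree `d`. -/
def RegM (d : ℕ) : Set (M₀ → ℝ) :=
  {f | ∃ p : MvPolynomial (((Fin 2 × Fin 2) ⊕ Fin 2) × Bool) ℝ, p.IsHomogeneous d ∧
    (∀ g : ↥SU2, ∀ x ∈ Vsub, evalR p (cc (act g x)) = evalR p (cc x)) ∧
    ∀ x : Mset, f (Quot.mk _ x) = evalR p (cc (x : W))}

/-- Orbit equivalence for a subgroup `H` of the unitary group acting on ℂᵐ. -/
def relH (m : ℕ) (H : Subgroup (Matrix.unitaryGroup (Fin m) ℂ)) (v w : Fin m → ℂ) : Prop :=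
  ∃ h ∈ H, w = Matrix.mulVec (h : Matrix (Fin m) (Fin m) ℂ) v

/-- The linear symplectic orbifold ℂᵐ/H with the quotient topology. -/
def Y (m : ℕ) (H : Subgroup (Matrix.unitaryGroup (Fin m) ℂ)) : Type := Quot (relH m H)

instance (m : ℕ) (H : Subgroup (Matrix.unitaryGroup (Fin m) ℂ)) : TopologicalSpace (Y m H) :=
  instTopologicalSpaceQuot

/-- The degree-`d` regular functions on `ℂᵐ/H`. -/
def RegY (m : ℕ) (H : Subgroup (Matrix.unitaryGroup (Fin m) ℂ)) (d : ℕ) :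
    Set (Y m H → ℝ) :=
  {f | ∃ p : MvPolynomial (Fin m × Bool) ℝ, p.IsHomogeneous d ∧
    (∀ h ∈ H, ∀ v : Fin m → ℂ,
      evalR p (Matrix.mulVec (h : Matrix (Fin m) (Fin m) ℂ) v) = evalR p v) ∧
    ∀ v : Fin m → ℂ, f (Quot.mk _ v) = evalR p v}

/-- The stabilizer (as a set) of `x` in SU(2). -/
def stabM (x : W) : Set ↥SU2 := {g | act g x = x}

/-- The orbit-type stratum of `M₀` corresponding to (the conjugacy class of) a subgroup
`L ≤ SU(2)`. -/
def stratM (L : Subgroup ↥SU2) : Set M₀ :=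
  {y | ∃ x : Mset, Quot.mk relM x = y ∧
    ∃ g₀ : ↥SU2, stabM (x : W) = (fun h => g₀ * h * g₀⁻¹) '' (L : Set ↥SU2)}

/-- The stabilizer (as a set) of `v` in `H`. -/
def stabH (m : ℕ) (H : Subgroup (Matrix.unitaryGroup (Fin m) ℂ)) (v : Fin m → ℂ) :
    Set ↥H :=
  {h | Matrix.mulVec ((h : Matrix.unitaryGroup (Fin m) ℂ) : Matrix (Fin m) (Fin m) ℂ) v = v}

/-- The orbit-type stratum of `ℂᵐ/H` corresponding to (the conjugacy class of) a subgroup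
`L' ≤ H`. -/
def stratY (m : ℕ) (H : Subgroup (Matrix.unitaryGroup (Fin m) ℂ)) (L' : Subgroup ↥H) :
    Set (Y m H) :=
  {y | ∃ v : Fin m → ℂ, Quot.mk (relH m H) v = y ∧
    ∃ h₀ : ↥H, stabH m H v = (fun h => h₀ * h * h₀⁻¹) '' (L' : Set ↥H)}

/-- The real coordinates of a complex vector, as a linear map. -/
def co (ι : Type) : (ι → ℂ) →ₗ[ℝ] (ι × Bool → ℝ) where
  toFun z q := if q.2 then (z q.1).im else (z q.1).re
  map_add' x y := by
    funext q; by_cases h : q.2 <;> simp [h]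
  map_smul' s x := by
    funext q; by_cases h : q.2 <;> simp [h]

lemma evalR_co {ι : Type} (p : MvPolynomial (ι × Bool) ℝ) (z : ι → ℂ) :
    evalR p z = MvPolynomial.eval (co ι z) p := rfl

lemma eval_smul_hom {σ : Type} {n : ℕ} {p : MvPolynomial σ ℝ} (hp : p.IsHomogeneous n)
    (s : ℝ) (x : σ → ℝ) : MvPolynomial.eval (s • x) p = s ^ n * MvPolynomial.eval x p := by
  rw [MvPolynomial.eval_eq, MvPolynomial.eval_eq, Finset.mul_sum]
  refine Finset.sum_congr rfl fun d hd => ?_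
  have h1 : ∏ i ∈ d.support, s ^ d i = s ^ n := by
    rw [Finset.prod_pow_eq_pow_sum]
    congr 1
    exact (hp.degree_eq_sum_deg_support hd).symm
  simp only [Pi.smul_apply, smul_eq_mul, mul_pow, Finset.prod_mul_distrib, h1]
  ring

lemma evalR_smul {ι : Type} {n : ℕ} {p : MvPolynomial (ι × Bool) ℝ} (hp : p.IsHomogeneous n)
    (s : ℝ) (z : ι → ℂ) : evalR p (s • z) = s ^ n * evalR p z := by
  rw [evalR_co, evalR_co, map_smul, eval_smul_hom hp]

lemma quad_coeffs {σ : Type} [Fintype σ] {p : MvPolynomial σ ℝ} (hp : p.IsHomogeneous 2) :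
    ∃ a : σ → σ → ℝ, ∀ x, MvPolynomial.eval x p = ∑ i, ∑ j, a i j * x i * x j := by
  have h0 : ∀ i j, ∃ c : ℝ, pderiv j (pderiv i p) = C c := fun i j =>
    ⟨_, totalDegree_eq_zero_iff_eq_C.mp
      ((totalDegree_zero_iff_isHomogeneous (p := _)).mpr
        ((hp.pderiv (i := i)).pderiv (i := j)))⟩
  choose a ha using h0
  have h1 : ∀ i x, MvPolynomial.eval x (pderiv i p) = ∑ j, x j * a i j := by
    intro i x
    have := congrArg (MvPolynomial.eval x) (hp.pderiv (i := i)).sum_X_mul_pderiv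
    simpa [ha] using this.symm
  refine ⟨fun i j => a i j / 2, fun x => ?_⟩
  have h2 := congrArg (MvPolynomial.eval x) hp.sum_X_mul_pderiv
  simp only [map_sum, map_mul, eval_X, h1, nsmul_eq_mul, map_natCast] at h2
  push_cast at h2
  have : MvPolynomial.eval x p = (∑ i, x i * ∑ j, x j * a i j) / 2 := by linarith
  rw [this, Finset.sum_div]
  refine Finset.sum_congr rfl fun i _ => ?_
  rw [Finset.mul_sum, Finset.sum_div]
  refine Finset.sum_congr rfl fun j _ => ?_
  ring

lemma quad_bilin {ι : Type} [Fintype ι] {p : MvPolynomial (ι × Bool) ℝ}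
    (hp : p.IsHomogeneous 2) :
    ∃ B : (ι → ℂ) →ₗ[ℝ] (ι → ℂ) →ₗ[ℝ] ℝ, (∀ x y, B x y = B y x) ∧
      ∀ x, evalR p x = B x x := by
  obtain ⟨a, ha⟩ := quad_coeffs hp
  let B : (ι → ℂ) →ₗ[ℝ] (ι → ℂ) →ₗ[ℝ] ℝ := LinearMap.mk₂ ℝ
    (fun x y => ∑ i, ∑ j, a i j * (co ι x i * co ι y j + co ι x j * co ι y i) / 2)
    (by intro x y z; simp only [map_add, Pi.add_apply, ← Finset.sum_add_distrib]
        refine Finset.sum_congr rfl fun i _ => Finset.sum_congr rfl fun j _ => ?_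
        ring)
    (by intro s x y; simp only [map_smul, Pi.smul_apply, smul_eq_mul, Finset.mul_sum]
        refine Finset.sum_congr rfl fun i _ => Finset.sum_congr rfl fun j _ => ?_
        ring)
    (by intro x y z; simp only [map_add, Pi.add_apply, ← Finset.sum_add_distrib]
        refine Finset.sum_congr rfl fun i _ => Finset.sum_congr rfl fun j _ => ?_
        ring)
    (by intro s x y; simp only [map_smul, Pi.smul_apply, smul_eq_mul, Finset.mul_sum]
        refine Finset.sum_congr rfl fun i _ => Finset.sum_congr rfl fun j _ => ?_
        ring)
  refine ⟨B, fun x y => ?_, fun x => ?_⟩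
  · simp only [B, LinearMap.mk₂_apply]
    refine Finset.sum_congr rfl fun i _ => Finset.sum_congr rfl fun j _ => ?_
    ring
  · rw [evalR_co, ha]
    simp only [B, LinearMap.mk₂_apply]
    refine Finset.sum_congr rfl fun i _ => Finset.sum_congr rfl fun j _ => ?_
    ring

/-- Real basis vectors of `ι → ℂ`. -/
def bas {ι : Type} [DecidableEq ι] (q : ι × Bool) : ι → ℂ :=
  Pi.single q.1 (if q.2 then Complex.I else 1)

lemma bas_sum {ι : Type} [Fintype ι] [DecidableEq ι] (x : ι → ℂ) :
    ∑ q : ι × Bool, co ι x q • bas q = x := by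
  rw [Fintype.sum_prod_type]
  funext k
  simp only [Finset.sum_apply, Fintype.sum_bool, bas, co, LinearMap.coe_mk, AddHom.coe_mk,
    Pi.add_apply, Pi.smul_apply]
  rw [Finset.sum_eq_single k]
  · apply Complex.ext <;> simp
  · intro b _ hb
    simp [hb.symm]
  · simp

lemma lin_poly {ι : Type} [Fintype ι] [DecidableEq ι] (L : (ι → ℂ) →ₗ[ℝ] ℝ) :
    ∃ p : MvPolynomial (ι × Bool) ℝ, p.IsHomogeneous 1 ∧ ∀ x, evalR p x = L x := by
  refine ⟨∑ q, C (L (bas q)) * X q, ?_, fun x => ?_⟩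
  · exact IsHomogeneous.sum _ _ _ fun q _ => isHomogeneous_C_mul_X _ _
  · conv_rhs => rw [← bas_sum x]
    rw [evalR_co]
    simp [mul_comm]

lemma bilin_poly {ι : Type} [Fintype ι] [DecidableEq ι]
    (B : (ι → ℂ) →ₗ[ℝ] (ι → ℂ) →ₗ[ℝ] ℝ) :
    ∃ p : MvPolynomial (ι × Bool) ℝ, p.IsHomogeneous 2 ∧ ∀ x, evalR p x = B x x := by
  choose P hP hP' using fun q : ι × Bool => lin_poly (B (bas q))
  refine ⟨∑ q, X q * P q, ?_, fun x => ?_⟩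
  · exact IsHomogeneous.sum _ _ _ fun q _ => (isHomogeneous_X _ q).mul (hP q)
  · have hx : B x x = B (∑ q : ι × Bool, co ι x q • bas q) x := by rw [bas_sum]
    rw [hx, map_sum, LinearMap.sum_apply, evalR_co]
    simp [← hP', evalR_co]

/-- A bounded polynomial is constant along lines. -/
lemma const_of_bounded {ι : Type} (p : MvPolynomial (ι × Bool) ℝ) (x y : ι → ℂ) (K : ℝ)
    (h : ∀ t : ℝ, |evalR p (x + t • y)| ≤ K) (t : ℝ) : evalR p (x + t • y) = evalR p x := by
  let P : Polynomial ℝ := MvPolynomial.eval₂ Polynomial.C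
    (fun q => Polynomial.C (co ι x q) + Polynomial.X * Polynomial.C (co ι y q)) p
  have hP : ∀ t, P.eval t = evalR p (x + t • y) := by
    intro t
    rw [evalR_co, ← Polynomial.coe_evalRingHom]
    simp only [P]
    rw [MvPolynomial.hom_eval₂]
    have : (Polynomial.evalRingHom t).comp Polynomial.C = RingHom.id ℝ := by ext; simp
    rw [this, MvPolynomial.eval₂_id]
    congr 2
    funext q
    simp only [Polynomial.coe_evalRingHom, Polynomial.eval_add, Polynomial.eval_C,
      Polynomial.eval_mul, Polynomial.eval_X, map_add, map_smul, Pi.add_apply, Pi.smul_apply,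
      smul_eq_mul]
  have hd : P.degree ≤ 0 := by
    rw [← Polynomial.isBoundedUnder_abs_atTop_iff]
    refine Filter.isBoundedUnder_of ⟨K, fun t => ?_⟩
    rw [hP]; exact h t
  have h0 := hP 0
  rw [Polynomial.eq_C_of_degree_le_zero hd] at hP h0
  simp only [Polynomial.eval_C, zero_smul, add_zero] at hP h0
  rw [← hP, h0]

lemma mg_inv (g : ↥SU2) : mg g⁻¹ = star (mg g) := rfl

lemma star_mg_mul (g : ↥SU2) : star (mg g) * mg g = 1 :=
  Matrix.UnitaryGroup.star_mul_self (g : Matrix.unitaryGroup (Fin 2) ℂ)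

lemma act_mem (g : ↥SU2) {x : W} (hx : x ∈ Mset) : act g x ∈ Mset := by
  obtain ⟨A, v⟩ := x
  obtain ⟨h1, h2⟩ := hx
  have hg := star_mg_mul g
  refine ⟨?_, fun ξ hξ hξ' => ?_⟩
  · simp only [act, mg_inv] at h1 ⊢
    rw [Matrix.trace_mul_cycle, hg, one_mul, h1]
  · have h3 := h2 (star (mg g) * ξ * mg g) (by
      rw [Matrix.trace_mul_cycle]
      have : mg g * star (mg g) = 1 := mul_eq_one_comm.mp hg
      rw [this, one_mul, hξ]) (by
      rw [star_mul, star_mul, star_star, hξ']; simp [mul_assoc])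
    simp only [act, mg_inv] at h3 ⊢
    set G := mg g with hG
    rw [← h3]
    congr 2
    · have e1 : (ξ * (G * A * star G) - G * A * star G * ξ) * star (G * A * star G)
          = G * ((star G * ξ * G * A - A * (star G * ξ * G)) * star A * star G) := by
        have hg' : ∀ X, star G * (G * X) = X := fun X => by rw [← mul_assoc, hg, one_mul]
        have hg2 : G * star G = 1 := mul_eq_one_comm.mp hg
        have hg3 : ∀ X, G * (star G * X) = X := fun X => by rw [← mul_assoc, hg2, one_mul]
        simp only [star_mul, star_star, mul_sub, sub_mul, mul_assoc, hg', hg3]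
      rw [e1, Matrix.trace_mul_comm, mul_assoc, hg, mul_one]
    · have e2 : ∀ u w : Fin 2 → ℂ, ∑ i, u i * (starRingEnd ℂ) (w i) = u ⬝ᵥ star w := by
        intro u w; rfl
      rw [e2, e2, Matrix.star_mulVec, ← Matrix.mulVec_mulVec, ← Matrix.mulVec_mulVec,
        dotProduct_comm, ← Matrix.dotProduct_mulVec, dotProduct_comm]
      rfl

/-- The slice points. -/
def sl (b c : ℂ) (r : ℝ) : W := (!![0, b; c, 0], ![(r : ℂ), 0])

lemma sl_mem (b c : ℂ) (r : ℝ) (h : normSq c - normSq b = r ^ 2 / 2) : sl b c r ∈ Mset := by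
  refine ⟨by simp [sl], fun ξ hξ hξ' => ?_⟩
  have h00 := congrFun (congrFun hξ' 0) 0
  have h01 := congrFun (congrFun hξ' 0) 1
  have h11 := congrFun (congrFun hξ' 1) 1
  rw [Matrix.trace_fin_two] at hξ
  simp only [Matrix.star_apply, Matrix.neg_apply] at h00 h01 h11
  have h3 := congrArg Complex.im hξ
  have h01r := congrArg Complex.re h01
  have h01i := congrArg Complex.im h01
  simp [normSq_apply] at h h3 h01r h01i
  simp [sl, Matrix.trace_fin_two, Matrix.mul_apply, Fin.sum_univ_two, Matrix.mulVec,
    Matrix.vecMul, dotProduct]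
  have h4 : (ξ 1 1).im = - (ξ 0 0).im := by linarith
  rw [h4]
  linear_combination (-2 * (ξ 0 0).im) * h

lemma sl_of_mem (A : Matrix (Fin 2) (Fin 2) ℂ) (r : ℝ) (hr : r ≠ 0)
    (h : ((A, ![(r : ℂ), 0]) : W) ∈ Mset) :
    ∃ b c : ℂ, normSq c - normSq b = r ^ 2 / 2 ∧ ((A, ![(r : ℂ), 0]) : W) = sl b c r := by
  obtain ⟨h0, h⟩ := h
  have e1 := h !![I, 0; 0, -I] (by simp) (by
    ext i j; fin_cases i <;> fin_cases j <;> simp)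
  have e2 := h !![0, 1; -1, 0] (by simp) (by
    ext i j; fin_cases i <;> fin_cases j <;> simp)
  have e3 := h !![0, I; I, 0] (by simp) (by
    ext i j; fin_cases i <;> fin_cases j <;> simp)
  simp only [Matrix.trace_fin_two] at h0
  have h11 : A 1 1 = - A 0 0 := by linear_combination h0
  simp [Matrix.trace_fin_two, Matrix.mul_apply, Fin.sum_univ_two, Matrix.mulVec,
    Matrix.vecMul, dotProduct, h11] at e1 e2 e3
  have hd : normSq (A 1 0) - normSq (A 0 1) = r ^ 2 / 2 := by
    simp only [normSq_apply]; linarith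
  have ha : A 0 0 * (starRingEnd ℂ) (A 1 0) = (starRingEnd ℂ) (A 0 0) * A 0 1 := by
    apply Complex.ext
    · simp; linarith
    · simp; linarith
  have hn := congrArg normSq ha
  simp only [normSq_mul, normSq_conj] at hn
  have hz : A 0 0 = 0 := by
    rw [← normSq_eq_zero]
    have : normSq (A 0 0) * (r ^ 2 / 2) = 0 := by rw [← hd]; linear_combination hn
    rcases mul_eq_zero.mp this with h | h
    · exact h
    · exfalso; apply hr; simpa using h
  refine ⟨A 0 1, A 1 0, hd, ?_⟩
  unfold sl
  congr 1
  ext i j; fin_cases i <;> fin_cases j <;> simp [hz, h11]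

/-- squared norm of the vector part -/
def vn (x : W) : ℝ := normSq (x.2 0) + normSq (x.2 1)

lemma exists_sl {x : W} (hx : x ∈ Mset) (hv : vn x ≠ 0) :
    ∃ (g : ↥SU2) (b c : ℂ) (r : ℝ), 0 < r ∧ r ^ 2 = vn x ∧
      normSq c - normSq b = r ^ 2 / 2 ∧ act g x = sl b c r := by
  obtain ⟨A, v⟩ := x
  have hpos : 0 < vn (A, v) := lt_of_le_of_ne (add_nonneg (normSq_nonneg _) (normSq_nonneg _))
    (Ne.symm hv)
  set r := Real.sqrt (vn (A, v)) with hrd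
  have hr : 0 < r := Real.sqrt_pos.mpr hpos
  have hr2 : r ^ 2 = vn (A, v) := Real.sq_sqrt hpos.le
  have hrc : (r : ℂ) ≠ 0 := by exact_mod_cast hr.ne'
  have hr2c : (r : ℂ) ^ 2 = (starRingEnd ℂ) (v 0) * v 0 + (starRingEnd ℂ) (v 1) * v 1 := by
    rw [← normSq_eq_conj_mul_self, ← normSq_eq_conj_mul_self]
    exact_mod_cast hr2
  let G : Matrix (Fin 2) (Fin 2) ℂ :=
    !![(starRingEnd ℂ) (v 0) / r, (starRingEnd ℂ) (v 1) / r; - v 1 / r, v 0 / r]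
  have hG : G ∈ Matrix.unitaryGroup (Fin 2) ℂ := by
    rw [Matrix.mem_unitaryGroup_iff]
    ext i j; fin_cases i <;> fin_cases j <;>
      simp [G, Matrix.mul_apply, Fin.sum_univ_two] <;> field_simp <;> rw [hr2c] <;> ring
  have hdet : G.det = 1 := by
    rw [Matrix.det_fin_two]
    simp only [G, Matrix.of_apply, Matrix.cons_val', Matrix.cons_val_zero, Matrix.cons_val_one,
      Matrix.cons_val_fin_one]
    field_simp
    rw [hr2c]; ring
  let g : ↥SU2 := ⟨⟨G, hG⟩, hdet⟩
  have hgv : act g (A, v) = ((mg g * A * mg g⁻¹, ![(r : ℂ), 0]) : W) := by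
    unfold act
    congr 1
    have : mg g = G := rfl
    rw [this]
    ext i; fin_cases i
    · simp [G, Matrix.mulVec, dotProduct, Fin.sum_univ_two]
      field_simp
      rw [hr2c]
    · simp [G, Matrix.mulVec, dotProduct, Fin.sum_univ_two]
      field_simp
      ring
  have hm := act_mem g hx
  rw [hgv] at hm
  obtain ⟨b, c, h1, h2⟩ := sl_of_mem _ r hr.ne' hm
  exact ⟨g, b, c, r, hr, hr2, h1, by rw [hgv, h2]⟩

lemma cc_act_sl (b c : ℂ) (r : ℝ) (s : ℝ) :
    cc (sl ((s : ℂ) * b) ((s : ℂ) * c) (s * r)) = s • cc (sl b c r) := by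
  funext q
  rcases q with ⟨i, j⟩ | i
  · fin_cases i <;> fin_cases j <;> simp [cc, sl]
  · fin_cases i <;> simp [cc, sl]

lemma cc_line (b c b' c' : ℂ) (r t : ℝ) :
    cc (sl (b + t * b') (c + t * c') r) = cc (sl b c r) + t • cc (sl b' c' 0) := by
  funext q
  rcases q with ⟨i, j⟩ | i
  · fin_cases i <;> fin_cases j <;> simp [cc, sl]
  · fin_cases i <;> simp [cc, sl]

/-- A function on `SL₂(ℝ)` invariant under row operations is constant. -/
lemma sl2_const (Φ : ℝ → ℝ → ℝ → ℝ → ℝ)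
    (h1 : ∀ a b c d t, a * d - b * c = 1 → Φ (a + t * c) (b + t * d) c d = Φ a b c d)
    (h2 : ∀ a b c d t, a * d - b * c = 1 → Φ a b (c + t * a) (d + t * b) = Φ a b c d)
    (a b c d : ℝ) (h : a * d - b * c = 1) : Φ a b c d = Φ 1 0 0 1 := by
  have key : ∀ a b c d : ℝ, a * d - b * c = 1 → c ≠ 0 → Φ a b c d = Φ 1 0 0 1 := by
    intro a b c d h hc
    have e1 := h1 a b c d ((1 - a) / c) h
    have ea : a + (1 - a) / c * c = 1 := by field_simp; ring
    rw [ea] at e1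
    set b' := b + (1 - a) / c * d with hb'
    have hdet : 1 * d - b' * c = 1 := by
      rw [hb']; field_simp; linear_combination h
    have e2 := h2 1 b' c d (-c) hdet
    have ec : c + -c * 1 = 0 := by ring
    have ed : d + -c * b' = 1 := by linear_combination hdet
    rw [ec, ed] at e2
    have e3 := h1 1 b' 0 1 (-b') (by ring)
    have e4 : (1 : ℝ) + -b' * 0 = 1 := by ring
    have e5 : b' + -b' * 1 = 0 := by ring
    rw [e4, e5] at e3
    rw [← e1, ← e2, ← e3]
  by_cases hc : c = 0
  · subst hc
    have ha : a ≠ 0 := by rintro rfl; simp at h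
    rw [← h2 a b 0 d 1 h]
    exact key _ _ _ _ (by linear_combination h) (by simpa using ha)
  · exact key a b c d h hc

/-- `SU(2)`-invariance of a polynomial on `V`. -/
def Inv (p : MvPolynomial (((Fin 2 × Fin 2) ⊕ Fin 2) × Bool) ℝ) : Prop :=
  ∀ g : ↥SU2, ∀ x ∈ Vsub, evalR p (cc (act g x)) = evalR p (cc x)

lemma vn_sl (b c : ℂ) (r : ℝ) : vn (sl b c r) = r ^ 2 := by
  simp [vn, sl]; ring

lemma sqrt2_sq : Real.sqrt 2 ^ 2 = 2 := Real.sq_sqrt (by norm_num)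

lemma lemmaA (p : MvPolynomial (((Fin 2 × Fin 2) ⊕ Fin 2) × Bool) ℝ) (n : ℕ) (hn : n ≠ 0)
    (hp : p.IsHomogeneous (2 * n)) (hinv : Inv p) (K : ℝ)
    (hb : ∀ x ∈ Mset, |evalR p (cc x)| ≤ K * vn x ^ n) :
    ∃ κ : ℝ, ∀ x ∈ Mset, evalR p (cc x) = κ * vn x ^ n := by
  have hline : ∀ b c b' c' : ℂ, (∀ t : ℝ, normSq (c + t * c') - normSq (b + t * b') = 1) →
      ∀ t : ℝ, evalR p (cc (sl (b + t * b') (c + t * c') (Real.sqrt 2)))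
        = evalR p (cc (sl b c (Real.sqrt 2))) := by
    intro b c b' c' h t
    rw [cc_line]
    apply const_of_bounded p _ _ (K * 2 ^ n)
    intro s
    rw [← cc_line]
    have := hb _ (sl_mem (b + s * b') (c + s * c') (Real.sqrt 2) (by rw [h, sqrt2_sq]; norm_num))
    rwa [vn_sl, sqrt2_sq] at this
  let bb : ℝ → ℝ → ℝ → ℝ → ℂ := fun α β γ d => ⟨(α - d) / 2, (β + γ) / 2⟩
  let cf : ℝ → ℝ → ℝ → ℝ → ℂ := fun α β γ d => ⟨(α + d) / 2, (γ - β) / 2⟩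
  let Φ : ℝ → ℝ → ℝ → ℝ → ℝ := fun α β γ d =>
    evalR p (cc (sl (bb α β γ d) (cf α β γ d) (Real.sqrt 2)))
  have hN : ∀ α β γ d, normSq (cf α β γ d) - normSq (bb α β γ d) = α * d - β * γ := by
    intro α β γ d; simp only [cf, bb, normSq_mk]; ring
  have r1b : ∀ α β γ d t : ℝ,
      bb (α + t * γ) (β + t * d) γ d = bb α β γ d + t * bb γ d 0 0 := by
    intro α β γ d t
    apply Complex.ext <;> simp [bb] <;> ring
  have r1c : ∀ α β γ d t : ℝ,
      cf (α + t * γ) (β + t * d) γ d = cf α β γ d + t * cf γ d 0 0 := by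
    intro α β γ d t
    apply Complex.ext <;> simp [cf] <;> ring
  have r2b : ∀ α β γ d t : ℝ,
      bb α β (γ + t * α) (d + t * β) = bb α β γ d + t * bb 0 0 α β := by
    intro α β γ d t
    apply Complex.ext <;> simp [bb] <;> ring
  have r2c : ∀ α β γ d t : ℝ,
      cf α β (γ + t * α) (d + t * β) = cf α β γ d + t * cf 0 0 α β := by
    intro α β γ d t
    apply Complex.ext <;> simp [cf] <;> ring
  have hΦ := sl2_const Φ
    (by
      intro α β γ d t h
      simp only [Φ]
      rw [r1b, r1c]
      apply hline
      intro s
      rw [← r1b, ← r1c, hN]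
      linear_combination h)
    (by
      intro α β γ d t h
      simp only [Φ]
      rw [r2b, r2c]
      apply hline
      intro s
      rw [← r2b, ← r2c, hN]
      linear_combination h)
  have hconst : ∀ b c : ℂ, normSq c - normSq b = 1 →
      evalR p (cc (sl b c (Real.sqrt 2))) = Φ 1 0 0 1 := by
    intro b c h
    have eb : bb (c.re + b.re) (b.im - c.im) (b.im + c.im) (c.re - b.re) = b := by
      apply Complex.ext <;> simp [bb]
    have ec : cf (c.re + b.re) (b.im - c.im) (b.im + c.im) (c.re - b.re) = c := by
      apply Complex.ext <;> simp [cf]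
    rw [← hΦ (c.re + b.re) (b.im - c.im) (b.im + c.im) (c.re - b.re)
      (by rw [← hN, eb, ec, h])]
    simp only [Φ]
    rw [eb, ec]
  refine ⟨Φ 1 0 0 1 / 2 ^ n, fun x hx => ?_⟩
  by_cases hv : vn x = 0
  · have := hb x hx
    rw [hv, zero_pow hn, mul_zero] at this ⊢
    exact abs_eq_zero.mp (le_antisymm this (abs_nonneg _))
  · obtain ⟨g, b, c, r, hr, hr2, hbc, hact⟩ := exists_sl hx hv
    rw [← hinv g x hx.1, hact]
    have h2 : (0 : ℝ) < Real.sqrt 2 := Real.sqrt_pos.mpr (by norm_num)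
    set s : ℝ := r / Real.sqrt 2 with hs
    have hs0 : s ≠ 0 := (div_pos hr h2).ne'
    have hs2 : s ^ 2 = r ^ 2 / 2 := by rw [hs, div_pow, sqrt2_sq]
    have hsc : (s : ℂ) ≠ 0 := by exact_mod_cast hs0
    have e : sl b c r = sl ((s : ℂ) * ((s⁻¹ : ℝ) * b)) ((s : ℂ) * ((s⁻¹ : ℝ) * c))
        (s * Real.sqrt 2) := by
      congr 1
      · push_cast; field_simp
      · push_cast; field_simp
      · rw [hs]; field_simp
    rw [e, cc_act_sl, evalR_smul hp, hconst, pow_mul, hs2, hr2]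
    · rw [div_pow]; field_simp
    · rw [normSq_mul, normSq_mul, normSq_ofReal, ← mul_sub, hbc, ← hs2]
      field_simp

lemma cc_add3 (b c : ℂ) (r : ℝ) :
    cc (sl b c r) = cc (sl b 0 0) + cc (sl 0 c 0) + cc (sl 0 0 r) := by
  funext q
  rcases q with ⟨i, j⟩ | i
  · fin_cases i <;> fin_cases j <;> simp [cc, sl]
  · fin_cases i <;> simp [cc, sl]

lemma sl_V (b c : ℂ) (r : ℝ) : sl b c r ∈ Vsub := by simp [Vsub, sl]

lemma lemmaB (p : MvPolynomial (((Fin 2 × Fin 2) ⊕ Fin 2) × Bool) ℝ)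
    (hp : p.IsHomogeneous 2) (hinv : Inv p)
    (hz : ∀ x ∈ Mset, vn x = 0 → evalR p (cc x) = 0) :
    ∃ κ : ℝ, ∀ x ∈ Mset, evalR p (cc x) = κ * vn x := by
  obtain ⟨B, hs, hB⟩ := quad_bilin hp
  -- abbreviations
  let e1 : ℂ → _ := fun b => cc (sl b 0 0)
  let e2 : ℂ → _ := fun c => cc (sl 0 c 0)
  let e3 : ℝ → _ := fun r => cc (sl 0 0 r)
  have sm1 : ∀ (s : ℝ) b, e1 (s * b) = s • e1 b := by
    intro s b; simp only [e1]; rw [← cc_act_sl]; simp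
  have sm2 : ∀ (s : ℝ) b, e2 (s * b) = s • e2 b := by
    intro s b; simp only [e2]; rw [← cc_act_sl]; simp
  have sm3 : ∀ (s : ℝ) b, e3 (s * b) = s • e3 b := by
    intro s b; simp only [e3]; rw [← cc_act_sl]; simp
  have ev : ∀ b c r, evalR p (cc (sl b c r)) = B (e1 b) (e1 b) + B (e2 c) (e2 c)
      + B (e3 r) (e3 r) + 2 * B (e1 b) (e2 c) + 2 * B (e1 b) (e3 r) + 2 * B (e2 c) (e3 r) := by
    intro b c r
    rw [hB, cc_add3]
    simp only [map_add, LinearMap.add_apply]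
    rw [hs (cc (sl 0 c 0)) (cc (sl b 0 0)), hs (cc (sl 0 0 r)) (cc (sl b 0 0)),
      hs (cc (sl 0 0 r)) (cc (sl 0 c 0))]
    ring
  have z1 : e1 0 = 0 := by have := sm1 0 0; simpa using this
  have z2 : e2 0 = 0 := by have := sm2 0 0; simpa using this
  have z3 : e3 0 = 0 := by have := sm3 0 0; simpa using this
  have n2 : ∀ c, e2 (-c) = - e2 c := by intro c; have := sm2 (-1) c; simpa using this
  have n3 : ∀ c, e3 (-c) = - e3 c := by intro c; have := sm3 (-1) c; simpa using this
  -- central element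
  have hm1 : (-1 : Matrix (Fin 2) (Fin 2) ℂ) ∈ Matrix.unitaryGroup (Fin 2) ℂ := by
    rw [Matrix.mem_unitaryGroup_iff]; simp
  let gm : ↥SU2 := ⟨⟨-1, hm1⟩, by
    change (-1 : Matrix (Fin 2) (Fin 2) ℂ).det = 1
    simp [Matrix.det_fin_two]⟩
  have hgm : ∀ b c r, act gm (sl b c r) = sl b c (-r) := by
    intro b c r
    have e : mg gm = -1 := rfl
    simp only [act, mg_inv, e, sl]
    congr 1
    · simp
    · ext i; fin_cases i <;> simp
  have hev : ∀ b c r, evalR p (cc (sl b c (-r))) = evalR p (cc (sl b c r)) := by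
    intro b c r
    rw [← hgm]; exact hinv gm _ (sl_V _ _ _)
  have hJm : (!![0, 1; -1, 0] : Matrix (Fin 2) (Fin 2) ℂ) ∈ Matrix.unitaryGroup (Fin 2) ℂ := by
    rw [Matrix.mem_unitaryGroup_iff]
    ext i j; fin_cases i <;> fin_cases j <;> simp [Matrix.mul_apply, Fin.sum_univ_two]
  let gj : ↥SU2 := ⟨⟨!![0, 1; -1, 0], hJm⟩, by
    change (!![0, 1; -1, 0] : Matrix (Fin 2) (Fin 2) ℂ).det = 1
    simp [Matrix.det_fin_two]⟩
  have hgj : ∀ b, act gj (sl b 0 0) = sl 0 (-b) 0 := by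
    intro b
    have e : mg gj = !![0, 1; -1, 0] := rfl
    simp only [act, mg_inv, e, sl]
    congr 1
    · ext i j; fin_cases i <;> fin_cases j <;>
        simp [Matrix.mul_apply, Fin.sum_univ_two, Matrix.vecMul, dotProduct]
    · ext i; fin_cases i <;> simp
  have h12 : ∀ b, B (e1 b) (e1 b) = B (e2 b) (e2 b) := by
    intro b
    have := hinv gj _ (sl_V b 0 0)
    rw [hgj, ev, ev, z1, z2, z3, n2] at this
    simpa using this.symm
  have hzero : ∀ b c, normSq b = normSq c →
      B (e1 b) (e1 b) + B (e2 c) (e2 c) + 2 * B (e1 b) (e2 c) = 0 := by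
    intro b c h
    have := hz _ (sl_mem b c 0 (by rw [h]; ring)) (by rw [vn_sl]; ring)
    rw [ev, z3] at this
    simpa using this
  have h1 : ∀ b, B (e1 b) (e1 b) = 0 := by
    intro b
    have t1 := hzero b b rfl
    have t2 := hzero b (-b) (by simp)
    rw [n2] at t2
    simp only [map_neg, LinearMap.neg_apply, neg_neg] at t2
    rw [← h12] at t1 t2
    linarith
  have hx12 : ∀ b c, B (e1 b) (e2 c) = 0 := by
    intro b c
    by_cases hb : b = 0
    · rw [hb, z1]; simp
    by_cases hc : c = 0
    · rw [hc, z2]; simp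
    have hbn : ‖b‖ ≠ 0 := by simpa using hb
    have hcn : ‖c‖ ≠ 0 := by simpa using hc
    have := hzero ((‖c‖ / ‖b‖ : ℝ) * b) c (by
      rw [normSq_mul, normSq_ofReal, normSq_eq_norm_sq, normSq_eq_norm_sq]; field_simp)
    rw [h1, ← h12, h1, sm1] at this
    simp only [map_smul, LinearMap.smul_apply, smul_eq_mul, zero_add] at this
    have hne : ‖c‖ / ‖b‖ ≠ 0 := div_ne_zero hcn hbn
    simpa [hbn, hcn, hb, hc] using this
  refine ⟨B (e3 1) (e3 1), fun x hx => ?_⟩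
  by_cases hv : vn x = 0
  · rw [hz x hx hv, hv, mul_zero]
  · obtain ⟨g, b, c, r, hr, hr2, hbc, hact⟩ := exists_sl hx hv
    rw [← hinv g x hx.1, hact, ← hr2]
    have t := hev b c r
    rw [ev, ev, n3] at t
    simp only [map_neg, LinearMap.neg_apply, neg_neg] at t
    have h33 : B (e3 r) (e3 r) = r ^ 2 * B (e3 1) (e3 1) := by
      have := sm3 r 1
      rw [mul_one] at this
      rw [this]; simp only [map_smul, LinearMap.smul_apply, smul_eq_mul]; ring
    rw [ev, h1, ← h12, h1, hx12, h33]
    linarith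

lemma vn_act (g : ↥SU2) (x : W) : vn (act g x) = vn x := by
  have e : ∀ y : W, ((vn y : ℝ) : ℂ) = y.2 ⬝ᵥ star y.2 := by
    intro y
    simp [vn, dotProduct, Fin.sum_univ_two, Complex.mul_conj]
  have : ((vn (act g x) : ℝ) : ℂ) = ((vn x : ℝ) : ℂ) := by
    rw [e, e]
    simp only [act]
    rw [Matrix.star_mulVec, dotProduct_comm, ← Matrix.dotProduct_mulVec, Matrix.mulVec_mulVec,
      ← Matrix.star_eq_conjTranspose, star_mg_mul, Matrix.one_mulVec, dotProduct_comm]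
  exact_mod_cast this

/-- The invariant polynomial `|v|²`. -/
lemma vn_poly : ∃ p : MvPolynomial (((Fin 2 × Fin 2) ⊕ Fin 2) × Bool) ℝ,
    p.IsHomogeneous 2 ∧ ∀ x, evalR p (cc x) = vn x := by
  refine ⟨∑ i : Fin 2, (X (Sum.inr i, false) ^ 2 + X (Sum.inr i, true) ^ 2), ?_, fun x => ?_⟩
  · exact IsHomogeneous.sum _ _ _ fun i _ =>
      (isHomogeneous_X_pow _ _).add (isHomogeneous_X_pow _ _)
  · simp [evalR, cc, vn, Fin.sum_univ_two, normSq_apply]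
    ring

section main
variable {m : ℕ} {H : Subgroup (Matrix.unitaryGroup (Fin m) ℂ)} (χ : M₀ ≃ₜ Y m H)

lemma pullback {d : ℕ} (hχ : (fun f : Y m H → ℝ => f ∘ ⇑χ) '' RegY m H d = RegM d)
    (P : MvPolynomial (Fin m × Bool) ℝ) (hP : P.IsHomogeneous d)
    (hinv : ∀ h ∈ H, ∀ v : Fin m → ℂ,
      evalR P (Matrix.mulVec (h : Matrix (Fin m) (Fin m) ℂ) v) = evalR P v) :
    ∃ p : MvPolynomial (((Fin 2 × Fin 2) ⊕ Fin 2) × Bool) ℝ, p.IsHomogeneous d ∧ Inv p ∧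
      ∀ (x : Mset) (y : Fin m → ℂ), χ (Quot.mk _ x) = Quot.mk _ y →
        evalR p (cc (x : W)) = evalR P y := by
  let f : Y m H → ℝ := Quot.lift (fun v => evalR P v) (by
    rintro v w ⟨h, hh, rfl⟩
    exact (hinv h hh v).symm)
  have hf : f ∘ χ ∈ RegM d := by
    rw [← hχ]; exact ⟨f, ⟨P, hP, hinv, fun v => rfl⟩, rfl⟩
  obtain ⟨p, h1, h2, h3⟩ := hf
  refine ⟨p, h1, h2, fun x y hxy => ?_⟩
  exact (h3 x).symm.trans (congrArg f hxy)

lemma pushforward {d : ℕ} (hχ : (fun f : Y m H → ℝ => f ∘ ⇑χ) '' RegY m H d = RegM d)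
    (p : MvPolynomial (((Fin 2 × Fin 2) ⊕ Fin 2) × Bool) ℝ) (hp : p.IsHomogeneous d)
    (hinv : Inv p) :
    ∃ P : MvPolynomial (Fin m × Bool) ℝ, P.IsHomogeneous d ∧
      (∀ h ∈ H, ∀ v : Fin m → ℂ,
        evalR P (Matrix.mulVec (h : Matrix (Fin m) (Fin m) ℂ) v) = evalR P v) ∧
      ∀ (x : Mset) (y : Fin m → ℂ), χ (Quot.mk _ x) = Quot.mk _ y →
        evalR p (cc (x : W)) = evalR P y := by
  let f : M₀ → ℝ := Quot.lift (fun x : Mset => evalR p (cc (x : W))) (by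
    rintro x y ⟨g, hg⟩
    simp only [hg]
    exact (hinv g _ x.2.1).symm)
  have hf : f ∈ RegM d := ⟨p, hp, hinv, fun x => rfl⟩
  rw [← hχ] at hf
  obtain ⟨F, ⟨P, h1, h2, h3⟩, hF⟩ := hf
  refine ⟨P, h1, h2, fun x y hxy => ?_⟩
  rw [← h3, ← hxy]
  exact (congrFun hF (Quot.mk _ x)).symm

lemma exists_x (y : Fin m → ℂ) : ∃ x : Mset, χ (Quot.mk _ x) = Quot.mk _ y := by
  obtain ⟨z, hz⟩ := χ.surjective (Quot.mk _ y)
  obtain ⟨x, rfl⟩ := Quot.exists_rep z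
  exact ⟨x, hz⟩

lemma exists_y (x : Mset) : ∃ y : Fin m → ℂ, χ (Quot.mk _ x) = Quot.mk _ y := by
  obtain ⟨y, hy⟩ := Quot.exists_rep (χ (Quot.mk _ x))
  exact ⟨y, hy.symm⟩

theorem no_graded (hH : (H : Set (Matrix.unitaryGroup (Fin m) ℂ)).Finite)
    (hχ : ∀ d : ℕ, (fun f : Y m H → ℝ => f ∘ ⇑χ) '' RegY m H d = RegM d) : False := by
  obtain ⟨pv, hpv, hpv'⟩ := vn_poly
  obtain ⟨PD, hPD, hPDinv, hPDx⟩ := pushforward χ (hχ 2) pv hpv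
    (fun g x _ => by rw [hpv', hpv', vn_act])
  obtain ⟨B, hs, hB⟩ := quad_bilin hPD
  have hBx : ∀ (x : Mset) (y : Fin m → ℂ), χ (Quot.mk _ x) = Quot.mk _ y →
      vn (x : W) = B y y := fun x y h => by rw [← hB, ← hPDx x y h, hpv']
  have hpos : ∀ y, 0 ≤ B y y := by
    intro y
    obtain ⟨x, hx⟩ := exists_x χ y
    rw [← hBx x y hx]
    exact add_nonneg (normSq_nonneg _) (normSq_nonneg _)
  -- Cauchy-Schwarz
  have hCS : ∀ x y, B x y ^ 2 ≤ B x x * B y y := by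
    intro x y
    have := LinearMap.BilinForm.apply_mul_apply_le_of_forall_zero_le B hpos x y
    rw [hs y x] at this
    nlinarith
  -- invariance
  have hDinv : ∀ h ∈ H, ∀ v : Fin m → ℂ,
      B (Matrix.mulVec (h : Matrix (Fin m) (Fin m) ℂ) v)
        (Matrix.mulVec (h : Matrix (Fin m) (Fin m) ℂ) v) = B v v := fun h hh v => by
    rw [← hB, ← hB, hPDinv h hh]
  have hBinv : ∀ h ∈ H, ∀ v w : Fin m → ℂ,
      B (Matrix.mulVec (h : Matrix (Fin m) (Fin m) ℂ) v)
        (Matrix.mulVec (h : Matrix (Fin m) (Fin m) ℂ) w) = B v w := by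
    intro h hh v w
    have := hDinv h hh (v + w)
    rw [Matrix.mulVec_add] at this
    simp only [map_add, LinearMap.add_apply] at this
    rw [hDinv h hh v, hDinv h hh w, hs (Matrix.mulVec _ w) (Matrix.mulVec _ v), hs w v] at this
    linarith
  -- multiplication by i
  let J : (Fin m → ℂ) →ₗ[ℝ] (Fin m → ℂ) :=
    { toFun := fun v => I • v
      map_add' := fun v w => smul_add _ _ _
      map_smul' := fun s v => by
        simp only [RingHom.id_apply]; exact smul_comm _ _ _ }
  have hJ : ∀ v, J v = I • v := fun v => rfl
  have hJJ : ∀ v, J (J v) = - v := fun v => by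
    rw [hJ, hJ, smul_smul, I_mul_I, neg_one_smul]
  obtain ⟨PG, hPG, hPG'⟩ := bilin_poly (B.compl₂ J)
  simp only [LinearMap.compl₂_apply] at hPG'
  obtain ⟨pg, hpg, hpgi, hpgx⟩ := pullback χ (hχ 2) PG hPG (by
    intro h hh v
    rw [hPG', hPG', hJ, ← Matrix.mulVec_smul, hBinv h hh, hJ])
  obtain ⟨κ, hκ⟩ := lemmaB pg hpg hpgi (by
    intro x hx hv
    obtain ⟨y, hy⟩ := exists_y χ ⟨x, hx⟩
    have hpx := hpgx _ _ hy
    have hvx := hBx _ _ hy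
    simp only at hpx hvx
    rw [hpx, hPG']
    have := hCS y (J y)
    rw [← hvx, hv, zero_mul] at this
    exact pow_eq_zero_iff (two_ne_zero) |>.mp (le_antisymm this (sq_nonneg _)))
  have hG : ∀ y, B y (J y) = κ * B y y := by
    intro y
    obtain ⟨x, hx⟩ := exists_x χ y
    rw [← hPG', ← hpgx x y hx, hκ x x.2, hBx x y hx]
  -- a point with D ≠ 0
  obtain ⟨y₁, hy₁⟩ : ∃ y, B y y ≠ 0 := by
    obtain ⟨y, hy⟩ := exists_y χ ⟨sl 0 1 (Real.sqrt 2), sl_mem _ _ _ (by rw [sqrt2_sq]; simp)⟩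
    refine ⟨y, ?_⟩
    rw [← hBx _ _ hy]
    simp only [vn_sl, sqrt2_sq]
    norm_num
  have hG0 : ∀ y, B y (J y) = 0 := by
    have hκ0 : κ = 0 := by
      have h1 := hG y₁
      have h2 := hG (J y₁)
      rw [hJJ, map_neg, hs (J y₁) y₁, h1] at h2
      have h3 : κ * (B y₁ y₁ + B (J y₁) (J y₁)) = 0 := by linarith
      rcases mul_eq_zero.mp h3 with h | h
      · exact h
      · exfalso; apply hy₁; linarith [hpos y₁, hpos (J y₁)]
    intro y; rw [hG, hκ0, zero_mul]
  obtain ⟨y₀, hy₀, hJy₀⟩ : ∃ y, B y y ≠ 0 ∧ B (J y) (J y) ≠ 0 := by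
    by_cases h : B (J y₁) (J y₁) = 0
    · refine ⟨y₁ + J y₁, ?_, ?_⟩
      · simp only [map_add, LinearMap.add_apply]
        rw [hs (J y₁) y₁, hG0, h]; simpa using hy₁
      · simp only [map_add, LinearMap.add_apply, hJJ, map_neg, LinearMap.neg_apply]
        rw [hs (J y₁) y₁, hG0, h]; simpa using hy₁
    · exact ⟨y₁, hy₁, h⟩
  -- the product polynomial
  haveI : Fintype ↥H := hH.fintype
  let L : ↥H → (Fin m → ℂ) →ₗ[ℝ] ℝ := fun h =>
    (B y₀).comp ((Matrix.mulVecLin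
      ((h : Matrix.unitaryGroup (Fin m) ℂ) : Matrix (Fin m) (Fin m) ℂ)).restrictScalars ℝ)
  have hL : ∀ h v, L h v = B y₀ (Matrix.mulVec
      ((h : Matrix.unitaryGroup (Fin m) ℂ) : Matrix (Fin m) (Fin m) ℂ) v) := fun h v => rfl
  choose Q hQ hQ' using fun h : ↥H => lin_poly (L h)
  let n := Fintype.card ↥H
  have hn : n ≠ 0 := Fintype.card_ne_zero
  have hU : (∏ h : ↥H, Q h ^ 2).IsHomogeneous (2 * n) := by
    have := IsHomogeneous.prod (Finset.univ : Finset ↥H) (fun h => Q h ^ 2) (fun _ => 2)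
      (fun h _ => by simpa using (hQ h).pow 2)
    simpa [n, mul_comm] using this
  have hUe : ∀ v, evalR (∏ h : ↥H, Q h ^ 2) v = ∏ h : ↥H, L h v ^ 2 := by
    intro v
    simp only [← hQ', evalR_co, map_prod, map_pow]
  obtain ⟨pu, hpu, hpui, hpux⟩ := pullback χ (hχ (2 * n)) (∏ h : ↥H, Q h ^ 2) hU (by
    intro k hk v
    rw [hUe, hUe]
    refine Fintype.prod_equiv (Equiv.mulRight (⟨k, hk⟩ : ↥H)) _ _ fun h => ?_
    rw [hL, hL, Matrix.mulVec_mulVec]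
    rfl)
  obtain ⟨κ', hκ'⟩ := lemmaA pu n hn hpu hpui (B y₀ y₀ ^ n) (by
    intro x hx
    obtain ⟨y, hy⟩ := exists_y χ ⟨x, hx⟩
    have hpx := hpux _ _ hy
    have hvx := hBx _ _ hy
    simp only at hpx hvx
    rw [hpx, hvx, hUe, abs_of_nonneg (Finset.prod_nonneg fun h _ => sq_nonneg _), ← mul_pow]
    calc ∏ h : ↥H, L h y ^ 2 ≤ ∏ h : ↥H, (B y₀ y₀ * B y y) := by
          refine Finset.prod_le_prod (fun h _ => sq_nonneg _) fun h _ => ?_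
          rw [hL, ← hDinv h.1 h.2 y]
          exact hCS _ _
      _ = _ := by simp [n])
  have hu : ∀ y, evalR (∏ h : ↥H, Q h ^ 2) y = κ' * B y y ^ n := by
    intro y
    obtain ⟨x, hx⟩ := exists_x χ y
    rw [← hpux x y hx, hκ' x x.2, hBx x y hx]
  have hκ0 : κ' = 0 := by
    have h1 := hu (J y₀)
    rw [hUe, Finset.prod_eq_zero (Finset.mem_univ (1 : ↥H))] at h1
    · rcases mul_eq_zero.mp h1.symm with h | h
      · exact h
      · exact absurd h (pow_ne_zero _ hJy₀)
    · rw [hL]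
      simp [hG0]
  have hzero : (∏ h : ↥H, Q h ^ 2) = 0 := by
    apply MvPolynomial.funext
    intro c
    have h1 := hu (fun i => ⟨c (i, false), c (i, true)⟩)
    rw [hκ0, zero_mul, evalR_co] at h1
    rw [map_zero, ← h1]
    congr 2
    funext ⟨i, t⟩
    cases t <;> simp [co]
  obtain ⟨h, -, hh⟩ := Finset.prod_eq_zero_iff.mp hzero
  have hQ0 : Q h = 0 := by simpa using hh
  have h1 := hQ' h (Matrix.mulVec (((h⁻¹ : ↥H) : Matrix.unitaryGroup (Fin m) ℂ) :
    Matrix (Fin m) (Fin m) ℂ) y₀)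
  rw [hQ0, hL, Matrix.mulVec_mulVec] at h1
  have h2 : ((h : Matrix.unitaryGroup (Fin m) ℂ) : Matrix (Fin m) (Fin m) ℂ) *
      (((h⁻¹ : ↥H) : Matrix.unitaryGroup (Fin m) ℂ) : Matrix (Fin m) (Fin m) ℂ) = 1 := by
    rw [← Matrix.UnitaryGroup.mul_val]
    simp
  rw [h2, Matrix.one_mulVec, evalR_co, map_zero] at h1
  exact hy₀ h1.symm

end main


/-- There is no orbit-type-stratum-preserving ℤ-graded regular diffeomorphism from the
symplectic quotient of the SU(2)-module `sl₂(ℂ) ⊕ ℂ² ≅ R₂ ⊕ R₁` to a linear symplectic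
orbifold. -/
theorem no_stratum_preserving_graded_regular_diffeomorphism_R2_R1
    (m : ℕ) (hm : 1 ≤ m) (H : Subgroup (Matrix.unitaryGroup (Fin m) ℂ))
    (hH : (H : Set (Matrix.unitaryGroup (Fin m) ℂ)).Finite) :
    ¬ ∃ χ : M₀ ≃ₜ Y m H,
        (∀ d : ℕ, (fun f : Y m H → ℝ => f ∘ ⇑χ) '' RegY m H d = RegM d) ∧
        (∀ L : Subgroup ↥SU2, ∃ L' : Subgroup ↥H, ⇑χ '' stratM L = stratY m H L') := by
  rintro ⟨χ, hχ, -⟩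
  exact no_graded χ hH hχ


end

end Stmt10
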